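/- arXiv:1008.3443 — 3 statements merged into one kernel-verified Lean document; each statement's English description precedes it below -/
import Mathlib

section
/- For any t > 0, a partition 𝒞* of V is submodular for μ_t if and only if it is weakly optimal for Q_t. -/
open Finset

variable {V : Type*} [Fintype V] [DecidableEq V]

noncomputable section

/-- `Z = ∑_{l,r} m(l,r)` as a real number. -/
def Zval (m : V → V → ℕ) : ℝ := ∑ l : V, ∑ r : V, (m l r : ℝ)

/-- The probability measure `m_E` on `V × V`. -/
def mE (m : V → V → ℕ) (S : Finset (V × V)) : ℝ :=
  (∑ p ∈ S, (m p.1 p.2 : ℝ)) / Zval m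

/-- The marginal probability `m_V` on `V`. -/
def mV (m : V → V → ℕ) (A : Finset V) : ℝ := mE m (A ×ˢ Finset.univ)

/-- The product measure `m_VV` on `V × V`. -/
def mVV (m : V → V → ℕ) (S : Finset (V × V)) : ℝ :=
  ∑ p ∈ S, mV m {p.1} * mV m {p.2}

/-- The signed measure `μ_t = m_E - t · m_VV`. -/
def mu (m : V → V → ℕ) (t : ℝ) (S : Finset (V × V)) : ℝ := mE m S - t * mVV m S

/-- `ρ(C) = m_E(C × (V ∖ C))`. -/
def rho (m : V → V → ℕ) (C : Finset V) : ℝ := mE m (C ×ˢ (Finset.univ \ C))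

/-- A partition of `V`: pairwise disjoint nonempty sets covering `V`. -/
def IsPartition (𝒞 : Finset (Finset V)) : Prop :=
  (∀ C ∈ 𝒞, C.Nonempty) ∧
  (∀ C ∈ 𝒞, ∀ C' ∈ 𝒞, C ≠ C' → Disjoint C C') ∧
  𝒞.sup id = Finset.univ

/-- The diagonal set `D(𝒞) = ∪_{C ∈ 𝒞} C × C`. -/
def Dset (𝒞 : Finset (Finset V)) : Finset (V × V) := 𝒞.sup fun C => C ×ˢ C

/-- The modularity at resolution `t`: `Q_t(𝒞) = μ_t(D(𝒞))`. -/
def Qmod (m : V → V → ℕ) (t : ℝ) (𝒞 : Finset (Finset V)) : ℝ := mu m t (Dset 𝒞)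

/-- The complement `Q̄_t(𝒞) = μ_t(D̄(𝒞))`. -/
def Qbar (m : V → V → ℕ) (t : ℝ) (𝒞 : Finset (Finset V)) : ℝ :=
  mu m t (Finset.univ \ Dset 𝒞)

/-- `𝒞` is submodular for `μ_t`: `μ_t(C × C') ≤ 0` for distinct `C, C' ∈ 𝒞`. -/
def Submodular (m : V → V → ℕ) (t : ℝ) (𝒞 : Finset (Finset V)) : Prop :=
  ∀ C ∈ 𝒞, ∀ C' ∈ 𝒞, C ≠ C' → mu m t (C ×ˢ C') ≤ 0

/-- `Coarsens 𝒞 𝒟` means `𝒞 ⪯ 𝒟`, i.e. `𝒟` refines `𝒞`: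
every element of `𝒞` is the union of the elements of `𝒟` it contains. -/
def Coarsens (𝒞 𝒟 : Finset (Finset V)) : Prop :=
  ∀ C ∈ 𝒞, C = (𝒟.filter fun D => D ⊆ C).sup id

/-- The resolution `t(𝒞)`: the maximum of `m_E(C×C') / m_VV(C×C')` over distinct
pairs of parts (`0` when there are no such pairs, e.g. `|𝒞| = 1`). -/
def resol (m : V → V → ℕ) (𝒞 : Finset (Finset V)) : ℝ :=
  ⨆ p : {p : Finset V × Finset V // p.1 ∈ 𝒞 ∧ p.2 ∈ 𝒞 ∧ p.1 ≠ p.2},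
    mE m ((p : Finset V × Finset V).1 ×ˢ (p : Finset V × Finset V).2) /
      mVV m ((p : Finset V × Finset V).1 ×ˢ (p : Finset V × Finset V).2)

/-- The graph `G` associated to `m`: an edge between `l ≠ r` iff `m(l,r) > 0`
(for symmetric `m` this is exactly the graph of the paper). -/
def graphOf (m : V → V → ℕ) : SimpleGraph V :=
  SimpleGraph.fromRel fun l r => 0 < m l r

/-- `α(𝒞) = m_VV(D(𝒞)) = ∑_{C ∈ 𝒞} m_V(C)²`. -/
def alphaP (m : V → V → ℕ) (𝒞 : Finset (Finset V)) : ℝ := mVV m (Dset 𝒞)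

open scoped Classical in
/-- `Z₀(𝒞)` at resolution `t`: the pairs of distinct parts with `μ_t(C × C') = 0`. -/
def Z0 (m : V → V → ℕ) (t : ℝ) (𝒞 : Finset (Finset V)) :
    Finset (Finset V × Finset V) :=
  (𝒞 ×ˢ 𝒞).filter fun p => p.1 ≠ p.2 ∧ mu m t (p.1 ×ˢ p.2) = 0

/-- The value `c*` of the minimum cut of `G` with weights `m`. -/
def mincut (m : V → V → ℕ) : ℝ :=
  ⨅ S : {S : Finset V // S.Nonempty ∧ S ≠ Finset.univ},
    ∑ l ∈ (S : Finset V), ∑ r ∈ Finset.univ \ (S : Finset V), (m l r : ℝ)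

end

theorem mem_Dset {𝒞 : Finset (Finset V)} {p : V × V} :
    p ∈ Dset 𝒞 ↔ ∃ C ∈ 𝒞, p.1 ∈ C ∧ p.2 ∈ C := by
  simp [Dset, Finset.mem_sup, Finset.mem_product]

theorem IsPartition.exists_mem {𝒞 : Finset (Finset V)} (h : IsPartition 𝒞) (x : V) :
    ∃ C ∈ 𝒞, x ∈ C := by
  have hx : x ∈ 𝒞.sup id := h.2.2 ▸ Finset.mem_univ x
  simpa [Finset.mem_sup] using hx

theorem IsPartition.eq_of_mem {𝒞 : Finset (Finset V)} (h : IsPartition 𝒞) {C D : Finset V}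
    {x : V} (hC : C ∈ 𝒞) (hD : D ∈ 𝒞) (hxC : x ∈ C) (hxD : x ∈ D) : C = D := by
  by_contra hne
  exact Finset.disjoint_left.mp (h.2.1 C hC D hD hne) hxC hxD

theorem Coarsens.exists_mem_subset {𝒞 𝒟 : Finset (Finset V)} (h : Coarsens 𝒞 𝒟)
    {C : Finset V} {x : V} (hC : C ∈ 𝒞) (hx : x ∈ C) : ∃ D ∈ 𝒟, D ⊆ C ∧ x ∈ D := by
  rw [h C hC] at hx
  simpa [Finset.mem_sup, and_assoc] using hx

theorem mu_eq_sum (m : V → V → ℕ) (t : ℝ) (S : Finset (V × V)) :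
    mu m t S = ∑ p ∈ S, ((m p.1 p.2 : ℝ) / Zval m - t * (mV m {p.1} * mV m {p.2})) := by
  rw [mu, mE, mVV, Finset.sum_sub_distrib, Finset.sum_div, Finset.mul_sum]

theorem mu_union (m : V → V → ℕ) (t : ℝ) {S T : Finset (V × V)} (h : Disjoint S T) :
    mu m t (S ∪ T) = mu m t S + mu m t T := by
  simp only [mu_eq_sum, Finset.sum_union h]

theorem mu_product_comm {m : V → V → ℕ} (hsym : ∀ l r, m l r = m r l) (t : ℝ)
    (A B : Finset V) : mu m t (A ×ˢ B) = mu m t (B ×ˢ A) := by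
  simp only [mu_eq_sum]
  rw [Finset.sum_product, Finset.sum_product_right]
  refine Finset.sum_congr rfl fun a _ => Finset.sum_congr rfl fun b _ => ?_
  rw [hsym a b, mul_comm (mV m {a})]

theorem Submodular.Qmod_le {m : V → V → ℕ} {t : ℝ} {𝒞 𝒟 : Finset (Finset V)}
    (hsub : Submodular m t 𝒟) (h𝒞 : IsPartition 𝒞) (h𝒟 : IsPartition 𝒟)
    (hcoarse : Coarsens 𝒞 𝒟) : Qmod m t 𝒞 ≤ Qmod m t 𝒟 := by
  have subset_of_mem {C D : Finset V} {x : V} (hC : C ∈ 𝒞) (hD : D ∈ 𝒟) (hxC : x ∈ C)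
      (hxD : x ∈ D) : D ⊆ C := by
    obtain ⟨E, hE, hEC, hxE⟩ := hcoarse.exists_mem_subset hC hxC
    rwa [h𝒟.eq_of_mem hD hE hxD hxE]
  let P := (𝒟 ×ˢ 𝒟).filter fun q => q.1 ≠ q.2 ∧ q.1 ×ˢ q.2 ⊆ Dset 𝒞
  have hD : Dset 𝒞 = Dset 𝒟 ∪ P.biUnion fun q => q.1 ×ˢ q.2 := by
    ext ⟨x, y⟩
    simp only [Finset.mem_union, Finset.mem_biUnion, Finset.mem_product]
    constructor
    · intro hxy
      obtain ⟨C, hC, hx, hy⟩ := mem_Dset.mp hxy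
      obtain ⟨D, hD, hDC, hxD⟩ := hcoarse.exists_mem_subset hC hx
      obtain ⟨E, hE, hEC, hyE⟩ := hcoarse.exists_mem_subset hC hy
      by_cases hDE : D = E
      · exact .inl (mem_Dset.mpr ⟨D, hD, hxD, hDE ▸ hyE⟩)
      · refine .inr ⟨(D, E), ?_, hxD, hyE⟩
        simp only [P, Finset.mem_filter, Finset.mem_product]
        refine ⟨⟨hD, hE⟩, hDE, fun p hp => ?_⟩
        rw [Finset.mem_product] at hp
        exact mem_Dset.mpr ⟨C, hC, hDC hp.1, hEC hp.2⟩
    · rintro (hxy | ⟨q, hq, hx, hy⟩)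
      · obtain ⟨D, hD, hx, hy⟩ := mem_Dset.mp hxy
        obtain ⟨C, hC, hxC⟩ := h𝒞.exists_mem x
        exact mem_Dset.mpr ⟨C, hC, hxC, subset_of_mem hC hD hxC hx hy⟩
      · exact (Finset.mem_filter.mp hq).2.2 (Finset.mem_product.mpr ⟨hx, hy⟩)
  have hdisj : Disjoint (Dset 𝒟) (P.biUnion fun q => q.1 ×ˢ q.2) := by
    rw [Finset.disjoint_left]
    intro p hp hp'
    obtain ⟨E, hE, hx, hy⟩ := mem_Dset.mp hp
    obtain ⟨q, hq, hpq⟩ := Finset.mem_biUnion.mp hp'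
    rw [Finset.mem_product] at hpq
    obtain ⟨hq, hne, -⟩ := Finset.mem_filter.mp hq
    rw [Finset.mem_product] at hq
    exact hne ((h𝒟.eq_of_mem hq.1 hE hpq.1 hx).trans (h𝒟.eq_of_mem hE hq.2 hy hpq.2))
  have hpair : (P : Set (Finset V × Finset V)).PairwiseDisjoint fun q => q.1 ×ˢ q.2 := by
    intro q hq r hr hqr
    have hq' := Finset.mem_product.mp (Finset.mem_filter.mp hq).1
    have hr' := Finset.mem_product.mp (Finset.mem_filter.mp hr).1
    refine Finset.disjoint_left.mpr fun p hp hp' => hqr ?_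
    rw [Finset.mem_product] at hp hp'
    exact Prod.ext (h𝒟.eq_of_mem hq'.1 hr'.1 hp.1 hp'.1) (h𝒟.eq_of_mem hq'.2 hr'.2 hp.2 hp'.2)
  have hnonpos : mu m t (P.biUnion fun q => q.1 ×ˢ q.2) ≤ 0 := by
    rw [mu_eq_sum, Finset.sum_biUnion hpair]
    refine Finset.sum_nonpos fun q hq => ?_
    obtain ⟨hq, hne, -⟩ := Finset.mem_filter.mp hq
    rw [Finset.mem_product] at hq
    rw [← mu_eq_sum]
    exact hsub q.1 hq.1 q.2 hq.2 hne
  rw [Qmod, Qmod, hD, mu_union m t hdisj]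
  linarith

/-- The family obtained from `𝒞` by merging the parts `C` and `D`. -/
def mergeParts (𝒞 : Finset (Finset V)) (C D : Finset V) : Finset (Finset V) :=
  insert (C ∪ D) ((𝒞.erase C).erase D)

theorem mem_mergeParts {𝒞 : Finset (Finset V)} {C D E : Finset V} :
    E ∈ mergeParts 𝒞 C D ↔ E = C ∪ D ∨ E ≠ D ∧ E ≠ C ∧ E ∈ 𝒞 := by
  simp [mergeParts]

theorem IsPartition.mergeParts {𝒞 : Finset (Finset V)} (h : IsPartition 𝒞) {C D : Finset V}
    (hC : C ∈ 𝒞) (hD : D ∈ 𝒞) : IsPartition (mergeParts 𝒞 C D) := by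
  have hdisj {E : Finset V} (hED : E ≠ D) (hEC : E ≠ C) (hE : E ∈ 𝒞) : Disjoint (C ∪ D) E :=
    Finset.disjoint_union_left.mpr ⟨h.2.1 C hC E hE hEC.symm, h.2.1 D hD E hE hED.symm⟩
  refine ⟨fun E hE => ?_, fun E hE F hF hEF => ?_, ?_⟩
  · rcases mem_mergeParts.mp hE with rfl | ⟨-, -, hE⟩
    · exact (h.1 C hC).mono Finset.subset_union_left
    · exact h.1 E hE
  · rcases mem_mergeParts.mp hE with rfl | ⟨hED, hEC, hE⟩ <;>
      rcases mem_mergeParts.mp hF with rfl | ⟨hFD, hFC, hF⟩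
    · exact absurd rfl hEF
    · exact hdisj hFD hFC hF
    · exact (hdisj hED hEC hE).symm
    · exact h.2.1 E hE F hF hEF
  · refine Finset.eq_univ_of_forall fun x => Finset.mem_sup.mpr ?_
    obtain ⟨E, hE, hx⟩ := h.exists_mem x
    by_cases hEC : E = C
    · exact ⟨C ∪ D, mem_mergeParts.mpr (.inl rfl), Finset.mem_union_left D (hEC ▸ hx)⟩
    by_cases hED : E = D
    · exact ⟨C ∪ D, mem_mergeParts.mpr (.inl rfl), Finset.mem_union_right C (hED ▸ hx)⟩
    exact ⟨E, mem_mergeParts.mpr (.inr ⟨hED, hEC, hE⟩), hx⟩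

theorem coarsens_mergeParts {𝒞 : Finset (Finset V)} {C D : Finset V}
    (hC : C ∈ 𝒞) (hD : D ∈ 𝒞) : Coarsens (mergeParts 𝒞 C D) 𝒞 := by
  intro E hE
  ext x
  simp only [Finset.mem_sup, Finset.mem_filter, id]
  refine ⟨fun hx => ?_, fun ⟨F, hF, hx⟩ => hF.2 hx⟩
  rcases mem_mergeParts.mp hE with rfl | ⟨-, -, hE⟩
  · rcases Finset.mem_union.mp hx with hx | hx
    · exact ⟨C, ⟨hC, Finset.subset_union_left⟩, hx⟩
    · exact ⟨D, ⟨hD, Finset.subset_union_right⟩, hx⟩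
  · exact ⟨E, ⟨hE, Finset.Subset.refl E⟩, hx⟩

theorem Dset_mergeParts {𝒞 : Finset (Finset V)} {C D : Finset V} (hC : C ∈ 𝒞) (hD : D ∈ 𝒞) :
    Dset (mergeParts 𝒞 C D) = Dset 𝒞 ∪ (C ×ˢ D ∪ D ×ˢ C) := by
  ext ⟨x, y⟩
  simp only [Finset.mem_union, Finset.mem_product, mem_Dset, mem_mergeParts]
  constructor
  · rintro ⟨E, rfl | ⟨-, -, hE⟩, hx, hy⟩
    · rw [Finset.mem_union] at hx hy
      grind
    · exact .inl ⟨E, hE, hx, hy⟩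
  · rintro (⟨E, hE, hx, hy⟩ | hxy)
    · by_cases hEC : E = C
      · exact ⟨C ∪ D, .inl rfl, by grind⟩
      by_cases hED : E = D
      · exact ⟨C ∪ D, .inl rfl, by grind⟩
      exact ⟨E, .inr ⟨hED, hEC, hE⟩, hx, hy⟩
    · exact ⟨C ∪ D, .inl rfl, by grind⟩

theorem Qmod_mergeParts {m : V → V → ℕ} (hsym : ∀ l r, m l r = m r l) (t : ℝ)
    {𝒞 : Finset (Finset V)} (h : IsPartition 𝒞) {C D : Finset V} (hC : C ∈ 𝒞) (hD : D ∈ 𝒞)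
    (hne : C ≠ D) : Qmod m t (mergeParts 𝒞 C D) = Qmod m t 𝒞 + 2 * mu m t (C ×ˢ D) := by
  have hCD : Disjoint (C ×ˢ D) (D ×ˢ C) :=
    Finset.disjoint_product.mpr (.inl (h.2.1 C hC D hD hne))
  have hdiag : Disjoint (Dset 𝒞) (C ×ˢ D ∪ D ×ˢ C) := by
    refine Finset.disjoint_left.mpr fun p hp hp' => hne ?_
    obtain ⟨E, hE, hx, hy⟩ := mem_Dset.mp hp
    simp only [Finset.mem_union, Finset.mem_product] at hp'
    rcases hp' with hp' | hp'
    · exact (h.eq_of_mem hC hE hp'.1 hx).trans (h.eq_of_mem hE hD hy hp'.2)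
    · exact (h.eq_of_mem hC hE hp'.2 hy).trans (h.eq_of_mem hE hD hx hp'.1)
  rw [Qmod, Qmod, Dset_mergeParts hC hD, mu_union m t hdiag, mu_union m t hCD,
    mu_product_comm hsym t D C, two_mul]

/-- For any `t > 0`, a partition `𝒞*` of `V` is submodular for `μ_t`
iff it is weakly optimal for `Q_t` (i.e. `Q_t(𝒞) ≤ Q_t(𝒞*)` for every partition
`𝒞 ⪯ 𝒞*`). -/
theorem stmt_3 (m : V → V → ℕ) (hsym : ∀ l r, m l r = m r l)
    (hZ : 0 < ∑ l : V, ∑ r : V, m l r) (hdeg : ∀ l : V, 0 < ∑ r : V, m l r)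
    (t : ℝ) (ht : 0 < t) (𝒞s : Finset (Finset V)) (h𝒞s : IsPartition 𝒞s) :
    Submodular m t 𝒞s ↔
      ∀ 𝒞 : Finset (Finset V), IsPartition 𝒞 → Coarsens 𝒞 𝒞s →
        Qmod m t 𝒞 ≤ Qmod m t 𝒞s := by
  refine ⟨fun hsub 𝒞 h𝒞 hcoarse => hsub.Qmod_le h𝒞 h𝒞s hcoarse, fun hopt C hC D hD hne => ?_⟩
  have hle := hopt _ (h𝒞s.mergeParts hC hD) (coarsens_mergeParts hC hD)
  rw [Qmod_mergeParts hsym t h𝒞s hC hD hne] at hle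
  linarith
end

section
/- Let t > 0 and C ⊆ V. Then μ_t(C×C) ≤ m_E(C×C)·(1 − t·m_V(C)) and μ_t(C×C) ≤ m_E(C×C)·(1 − 2t·ρ(C)). If in addition t ≤ 1, then μ_t(C×C) ≥ −t·ρ(C)². -/
open Finset

variable {V : Type*} [Fintype V] [DecidableEq V]

lemma mE_nonneg (m : V → V → ℕ) (S : Finset (V × V)) : 0 ≤ mE m S := by
  unfold mE Zval
  positivity

lemma mE_union (m : V → V → ℕ) {S T : Finset (V × V)} (h : Disjoint S T) :
    mE m (S ∪ T) = mE m S + mE m T := by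
  unfold mE
  rw [Finset.sum_union h, add_div]

lemma mE_univ_le_one (m : V → V → ℕ) : mE m Finset.univ ≤ 1 := by
  unfold mE Zval
  rw [Fintype.sum_prod_type]
  exact div_self_le_one _

lemma mE_prod_comm (m : V → V → ℕ) (hsym : ∀ l r, m l r = m r l) (A B : Finset V) :
    mE m (A ×ˢ B) = mE m (B ×ˢ A) := by
  unfold mE
  rw [Finset.sum_product, Finset.sum_product_right]
  simp only [hsym]

lemma mV_eq_add_rho (m : V → V → ℕ) (C : Finset V) :
    mV m C = mE m (C ×ˢ C) + rho m C := by
  unfold mV rho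
  rw [← mE_union m (Finset.disjoint_product.2 (Or.inr Finset.disjoint_sdiff)),
    ← Finset.product_union, Finset.union_sdiff_of_subset (Finset.subset_univ C)]

lemma mV_eq_sum_singleton (m : V → V → ℕ) (C : Finset V) :
    mV m C = ∑ l ∈ C, mV m {l} := by
  simp [mV, mE, Finset.sum_product, Finset.sum_div]

lemma mVV_prod (m : V → V → ℕ) (A B : Finset V) :
    mVV m (A ×ˢ B) = mV m A * mV m B := by
  rw [mV_eq_sum_singleton m A, mV_eq_sum_singleton m B, Finset.sum_mul_sum,
    mVV, Finset.sum_product]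

lemma mV_add_mV_compl (m : V → V → ℕ) (C : Finset V) :
    mV m C + mV m (Finset.univ \ C) = mE m Finset.univ := by
  unfold mV
  rw [← mE_union m (Finset.disjoint_product.2 (Or.inl Finset.disjoint_sdiff)),
    ← Finset.union_product, Finset.union_sdiff_of_subset (Finset.subset_univ C),
    Finset.univ_product_univ]

lemma mE_self_add_two_mul_rho_le_one (m : V → V → ℕ) (hsym : ∀ l r, m l r = m r l)
    (C : Finset V) : mE m (C ×ˢ C) + 2 * rho m C ≤ 1 := by
  have hcompl : rho m (Finset.univ \ C) = rho m C := by
    unfold rho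
    rw [Finset.sdiff_sdiff_eq_self (Finset.subset_univ C), mE_prod_comm m hsym]
  have hsum := mV_add_mV_compl m C
  rw [mV_eq_add_rho, mV_eq_add_rho, hcompl] at hsum
  linarith [mE_univ_le_one m, mE_nonneg m ((Finset.univ \ C) ×ˢ (Finset.univ \ C))]

/-- Let `t > 0` and `C ⊆ V`. Then
`μ_t(C×C) ≤ m_E(C×C)·(1 − t·m_V(C))`, `μ_t(C×C) ≤ m_E(C×C)·(1 − 2t·ρ(C))`,
and if moreover `t ≤ 1` then `μ_t(C×C) ≥ −t·ρ(C)²`. -/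
theorem stmt_7 (m : V → V → ℕ) (hsym : ∀ l r, m l r = m r l)
    (hZ : 0 < ∑ l : V, ∑ r : V, m l r) (hdeg : ∀ l : V, 0 < ∑ r : V, m l r)
    (t : ℝ) (ht : 0 < t) (C : Finset V) :
    mu m t (C ×ˢ C) ≤ mE m (C ×ˢ C) * (1 - t * mV m C) ∧
    mu m t (C ×ˢ C) ≤ mE m (C ×ˢ C) * (1 - 2 * t * rho m C) ∧
    (t ≤ 1 → -(t * rho m C ^ 2) ≤ mu m t (C ×ˢ C)) := by
  have hx : 0 ≤ mE m (C ×ˢ C) := mE_nonneg m _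
  have hr : 0 ≤ rho m C := mE_nonneg m _
  have hle := mE_self_add_two_mul_rho_le_one m hsym C
  rw [mu, mVV_prod, mV_eq_add_rho]
  generalize mE m (C ×ˢ C) = x at *
  generalize rho m C = r at *
  have hxr : 0 ≤ t * (x * r) := by positivity
  have hx2 : 0 ≤ t * x ^ 2 := by positivity
  have hr2 : 0 ≤ t * r ^ 2 := by positivity
  refine ⟨by linarith, by linarith, fun ht1 => ?_⟩
  have hscaled : t * (x + 2 * r) ≤ 1 := mul_le_one₀ ht1 (by positivity) hle
  linarith [mul_le_mul_of_nonneg_left hscaled hx]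
end

section
/- Let G be a tree on vertex set V, let m be its adjacency matrix (m(l,r) = 1 if {l,r} is an edge, 0 otherwise), and let 𝒞 be an internally connected partition of V. Then Q_1(𝒞) = 1 − 2(|𝒞|−1)/Z − 1/|𝒞| − Σ_{C∈𝒞} (m_V(C) − 1/|𝒞|)². -/
open Finset

variable {V : Type*} [Fintype V] [DecidableEq V]

/-- The adjacency indicator of a finite tree sums to twice the number of vertices minus two. -/
lemma SimpleGraph.IsTree.sum_adj_add_two {W : Type*} [Fintype W] {H : SimpleGraph W}
    [DecidableRel H.Adj] (hH : H.IsTree) :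
    (∑ l : W, ∑ r : W, if H.Adj l r then 1 else 0) + 2 = 2 * Fintype.card W := by
  classical
  have h1 := hH.card_edgeFinset
  have h2 := H.sum_degrees_eq_twice_card_edges
  have h3 : ∀ l : W, (∑ r : W, if H.Adj l r then 1 else 0) = H.degree l := fun l => by
    rw [← H.card_neighborFinset_eq_degree, H.neighborFinset_eq_filter, Finset.card_filter]
  simp only [h3]
  omega

omit [Fintype V] [DecidableEq V] in
lemma graphOf_adj_iff {m : V → V → ℕ} (hsym : ∀ l r, m l r = m r l) (hloop : ∀ l, m l l = 0)
    (l r : V) : (graphOf m).Adj l r ↔ 0 < m l r := by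
  rw [graphOf, SimpleGraph.fromRel_adj, hsym r l, or_self]
  refine ⟨fun h => h.2, fun h => ⟨?_, h⟩⟩
  rintro rfl
  simp [hloop] at h

omit [Fintype V] [DecidableEq V] in
lemma eq_ite_graphOf_adj {m : V → V → ℕ} (hsym : ∀ l r, m l r = m r l)
    (hloop : ∀ l, m l l = 0) (h01 : ∀ l r, m l r ≤ 1) [DecidableRel (graphOf m).Adj] (l r : V) :
    m l r = if (graphOf m).Adj l r then 1 else 0 := by
  have := h01 l r
  split_ifs with h <;> rw [graphOf_adj_iff hsym hloop] at h <;> omega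

omit [Fintype V] [DecidableEq V] in
/-- A connected set of vertices of a tree spans `|C| - 1` edges. -/
lemma sum_product_self_add_two {m : V → V → ℕ} (hsym : ∀ l r, m l r = m r l)
    (hloop : ∀ l, m l l = 0) (h01 : ∀ l r, m l r ≤ 1) (htree : (graphOf m).IsTree)
    {C : Finset V} (hC : ((graphOf m).induce (C : Set V)).Connected) :
    (∑ p ∈ C ×ˢ C, m p.1 p.2) + 2 = 2 * C.card := by
  classical
  have h := SimpleGraph.IsTree.sum_adj_add_two
    (H := (graphOf m).induce (C : Set V)) ⟨hC, htree.isAcyclic.induce _⟩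
  simp only [SimpleGraph.comap_adj, Function.Embedding.subtype_apply,
    ← eq_ite_graphOf_adj hsym hloop h01] at h
  rw [Finset.sum_product, ← Finset.sum_coe_sort C]
  simp only [← Finset.sum_coe_sort C (fun r => m _ r)]
  simpa using h

omit [DecidableEq V] in
lemma sum_sum_add_two {m : V → V → ℕ} (hsym : ∀ l r, m l r = m r l)
    (hloop : ∀ l, m l l = 0) (h01 : ∀ l r, m l r ≤ 1) (htree : (graphOf m).IsTree) :
    (∑ l : V, ∑ r : V, m l r) + 2 = 2 * Fintype.card V := by
  classical
  simp only [eq_ite_graphOf_adj hsym hloop h01]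
  exact htree.sum_adj_add_two

lemma IsPartition.sum_Dset {𝒞 : Finset (Finset V)} (h𝒞 : IsPartition 𝒞) (f : V × V → ℝ) :
    ∑ p ∈ Dset 𝒞, f p = ∑ C ∈ 𝒞, ∑ p ∈ C ×ˢ C, f p := by
  rw [Dset, Finset.sup_eq_biUnion, Finset.sum_biUnion]
  intro C hC C' hC' hne
  exact Finset.disjoint_product.2 (Or.inl (h𝒞.2.1 C hC C' hC' hne))

lemma IsPartition.sum_univ {𝒞 : Finset (Finset V)} (h𝒞 : IsPartition 𝒞) (f : V → ℝ) :
    ∑ v, f v = ∑ C ∈ 𝒞, ∑ v ∈ C, f v := by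
  rw [← h𝒞.2.2, Finset.sup_eq_biUnion, Finset.sum_biUnion]
  · rfl
  · intro C hC C' hC' hne
    exact h𝒞.2.1 C hC C' hC' hne

omit [DecidableEq V] in
lemma sum_mV_singleton (m : V → V → ℕ) (C : Finset V) : ∑ v ∈ C, mV m {v} = mV m C := by
  simp only [mV, mE, Finset.sum_product, Finset.sum_singleton, Finset.sum_div]

omit [DecidableEq V] in
lemma mV_univ {m : V → V → ℕ} (hZ : Zval m ≠ 0) : mV m Finset.univ = 1 := by
  rw [mV, mE, Finset.sum_product]
  exact div_self hZ

lemma IsPartition.mVV_Dset {𝒞 : Finset (Finset V)} (h𝒞 : IsPartition 𝒞) (m : V → V → ℕ) :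
    mVV m (Dset 𝒞) = ∑ C ∈ 𝒞, mV m C ^ 2 := by
  rw [mVV, h𝒞.sum_Dset]
  refine Finset.sum_congr rfl fun C _ => ?_
  simp only [Finset.sum_product, ← Finset.sum_mul_sum, sum_mV_singleton, sq]

lemma IsPartition.sum_mV {𝒞 : Finset (Finset V)} (h𝒞 : IsPartition 𝒞) {m : V → V → ℕ}
    (hZ : Zval m ≠ 0) : ∑ C ∈ 𝒞, mV m C = 1 := by
  rw [← mV_univ hZ, ← sum_mV_singleton m Finset.univ, h𝒞.sum_univ]
  simp only [sum_mV_singleton]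

lemma IsPartition.sum_card {𝒞 : Finset (Finset V)} (h𝒞 : IsPartition 𝒞) :
    ∑ C ∈ 𝒞, (C.card : ℝ) = Fintype.card V := by
  simpa using (h𝒞.sum_univ fun _ => (1 : ℝ)).symm

/-- The part of the edge measure of a tree inside the parts of an internally connected
partition: exactly `|𝒞| - 1` edges are cut. -/
lemma IsPartition.mE_Dset {𝒞 : Finset (Finset V)} (h𝒞 : IsPartition 𝒞) {m : V → V → ℕ}
    (hZ : Zval m ≠ 0) (hsym : ∀ l r, m l r = m r l) (hloop : ∀ l, m l l = 0)
    (h01 : ∀ l r, m l r ≤ 1) (htree : (graphOf m).IsTree)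
    (hic : ∀ C ∈ 𝒞, ((graphOf m).induce (C : Set V)).Connected) :
    mE m (Dset 𝒞) = 1 - 2 * ((𝒞.card : ℝ) - 1) / Zval m := by
  have hpart : ∀ C ∈ 𝒞, ∑ p ∈ C ×ˢ C, (m p.1 p.2 : ℝ) = 2 * (C.card : ℝ) - 2 := by
    intro C hC
    have := sum_product_self_add_two hsym hloop h01 htree (hic C hC)
    rw [eq_sub_iff_add_eq]
    exact_mod_cast this
  have hZcard : Zval m + 2 = 2 * (Fintype.card V : ℝ) := by
    rw [Zval]
    exact_mod_cast sum_sum_add_two hsym hloop h01 htree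
  have hsum : ∑ p ∈ Dset 𝒞, (m p.1 p.2 : ℝ) = Zval m - 2 * ((𝒞.card : ℝ) - 1) := by
    rw [h𝒞.sum_Dset fun p => (m p.1 p.2 : ℝ), Finset.sum_congr rfl hpart,
      Finset.sum_sub_distrib, ← Finset.mul_sum, h𝒞.sum_card, Finset.sum_const, nsmul_eq_mul]
    linarith
  rw [mE, hsum, sub_div, div_self hZ]

/-- If `G` is a tree with adjacency matrix `m` and `𝒞` is an
internally connected partition of `V`, then
`Q_1(𝒞) = 1 − 2(|𝒞|−1)/Z − 1/|𝒞| − ∑_{C∈𝒞} (m_V(C) − 1/|𝒞|)²`. -/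
theorem stmt_19 (m : V → V → ℕ) (hsym : ∀ l r, m l r = m r l)
    (hZ : 0 < ∑ l : V, ∑ r : V, m l r) (hdeg : ∀ l : V, 0 < ∑ r : V, m l r)
    (hloop : ∀ l, m l l = 0) (h01 : ∀ l r, m l r ≤ 1)
    (htree : (graphOf m).IsTree)
    (𝒞 : Finset (Finset V)) (h𝒞 : IsPartition 𝒞)
    (hic : ∀ C ∈ 𝒞, ((graphOf m).induce (C : Set V)).Connected) :
    Qmod m 1 𝒞 = 1 - 2 * ((𝒞.card : ℝ) - 1) / Zval m - 1 / (𝒞.card : ℝ) -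
      ∑ C ∈ 𝒞, (mV m C - 1 / (𝒞.card : ℝ)) ^ 2 := by
  have hZ' : Zval m ≠ 0 := by
    rw [Zval]
    exact_mod_cast hZ.ne'
  have hsum := h𝒞.sum_mV hZ'
  have hk : (𝒞.card : ℝ) ≠ 0 := by
    rw [Nat.cast_ne_zero, Finset.card_ne_zero, Finset.nonempty_iff_ne_empty]
    rintro rfl
    simp at hsum
  have hsq : ∑ C ∈ 𝒞, (mV m C - 1 / (𝒞.card : ℝ)) ^ 2 =
      ∑ C ∈ 𝒞, mV m C ^ 2 - 1 / (𝒞.card : ℝ) := by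
    simp only [sub_sq, Finset.sum_add_distrib, Finset.sum_sub_distrib, ← Finset.sum_mul,
      ← Finset.mul_sum, hsum, Finset.sum_const, nsmul_eq_mul]
    field_simp
    ring
  rw [Qmod, mu, h𝒞.mE_Dset hZ' hsym hloop h01 htree hic, h𝒞.mVV_Dset, hsq]
  ring
end
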